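/- Let G be a finite bipartite multigraph. The set 𝖫_G of nonnegative solutions of L_G consists of exactly one point if and only if G has exactly one perfect matching; and in that case the unique nonnegative solution is t_M for the unique perfect matching M. -/

import Mathlib

open Finset

variable {Vp Vn E : Type*} [Fintype Vp] [Fintype Vn] [Fintype E]
  [DecidableEq Vp] [DecidableEq Vn] [DecidableEq E]

/-- `t : E → ℝ` solves the linear system `L_G`: at every positive vertex `v` the
weights of the edges incident to `v` sum to `2`, and similarly for negative vertices. -/
def SolvesLG (p : E → Vp) (q : E → Vn) (t : E → ℝ) : Prop :=
  (∀ v : Vp, ∑ e ∈ Finset.univ.filter (fun e => p e = v), t e = 2) ∧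
  (∀ v : Vn, ∑ e ∈ Finset.univ.filter (fun e => q e = v), t e = 2)

/-- The set `𝖫_G` of nonnegative solutions of `L_G`. -/
def LGset (p : E → Vp) (q : E → Vn) : Set (E → ℝ) :=
  {t | SolvesLG p q t ∧ ∀ e, 0 ≤ t e}

/-- `M` is a perfect matching of `G`: every positive vertex is the `p`-endpoint of
exactly one edge of `M`, and every negative vertex is the `q`-endpoint of exactly one
edge of `M`. -/
def IsPerfectMatching (p : E → Vp) (q : E → Vn) (M : Set E) : Prop :=
  (∀ v : Vp, ∃! e, e ∈ M ∧ p e = v) ∧ (∀ v : Vn, ∃! e, e ∈ M ∧ q e = v)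

/-- The point `t_M` associated to a perfect matching `M`: value `2` on edges of `M`
and `0` elsewhere. -/
noncomputable def tM (M : Set E) : E → ℝ := M.indicator fun _ => 2

/-- If the weights over each fibre of `g` sum to `2`, the weights over the preimage of a finset `A`
sum to `2 * #A`. -/
lemma sum_filter_mem_eq_two_mul_card {V E : Type*} [Fintype E] [DecidableEq V]
    {g : E → V} {t : E → ℝ} (h : ∀ v, ∑ e with g e = v, t e = 2) (A : Finset V) :
    ∑ e with g e ∈ A, t e = 2 * #A := by
  rw [← Finset.sum_fiberwise_of_maps_to (t := A) (g := g) (by simp)]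
  have hfib : ∀ v ∈ A, ∑ e ∈ univ.filter (fun e => g e ∈ A) with g e = v, t e = 2 := by
    intro v hv
    rw [← h v, Finset.filter_filter]
    exact Finset.sum_congr (Finset.filter_congr (by grind)) fun _ _ => rfl
  rw [Finset.sum_congr rfl hfib, Finset.sum_const, nsmul_eq_mul, mul_comm]

/-- The support of a nonnegative solution of `L_G` contains a perfect matching. -/
lemma exists_isPerfectMatching_subset_support {p : E → Vp} {q : E → Vn} {t : E → ℝ}
    (ht : t ∈ LGset p q) : ∃ M, IsPerfectMatching p q M ∧ ∀ e ∈ M, 0 < t e := by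
  classical
  obtain ⟨⟨hp, hq⟩, h0⟩ := ht
  obtain ⟨f, hf, hr⟩ := (Fintype.all_card_le_filter_rel_iff_exists_injective
    (fun (a : Vp) (b : Vn) => ∃ e, p e = a ∧ q e = b ∧ 0 < t e)).1 (by
      intro A
      have hA := sum_filter_mem_eq_two_mul_card hp A
      have hB := sum_filter_mem_eq_two_mul_card hq
        {b | ∃ a ∈ A, ∃ e, p e = a ∧ q e = b ∧ 0 < t e}
      have hle : ∑ e with p e ∈ A, t e ≤
          ∑ e with q e ∈ ({b | ∃ a ∈ A, ∃ e, p e = a ∧ q e = b ∧ 0 < t e} : Finset Vn), t e := by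
        rw [Finset.sum_filter, Finset.sum_filter]
        refine Finset.sum_le_sum fun e _ => ?_
        rcases (h0 e).eq_or_lt with he | he
        · simp [← he]
        · by_cases hpe : p e ∈ A
          · have hqe : ∃ a ∈ A, ∃ e', p e' = a ∧ q e' = q e ∧ 0 < t e' :=
              ⟨p e, hpe, e, rfl, rfl, he⟩
            rw [if_pos hpe, if_pos (by simpa using hqe)]
          · rw [if_neg hpe]
            split_ifs <;> simp [he.le]
      have : (#A : ℝ) ≤ #{b | ∃ a ∈ A, ∃ e, p e = a ∧ q e = b ∧ 0 < t e} := by linarith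
      exact_mod_cast this)
  have hcard : Fintype.card Vp = Fintype.card Vn := by
    have hP := sum_filter_mem_eq_two_mul_card hp univ
    have hQ := sum_filter_mem_eq_two_mul_card hq univ
    simp only [Finset.mem_univ, Finset.filter_true, Finset.card_univ] at hP hQ
    have : (Fintype.card Vp : ℝ) = Fintype.card Vn := by linarith
    exact_mod_cast this
  have hbij := (Fintype.bijective_iff_injective_and_card f).2 ⟨hf, hcard⟩
  choose g hgp hgq hg using hr
  refine ⟨Set.range g, ⟨fun v => ⟨g v, ⟨⟨v, rfl⟩, hgp v⟩, ?_⟩, fun w => ?_⟩, ?_⟩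
  · rintro _ ⟨⟨u, rfl⟩, hu⟩
    rw [← hu, hgp]
  · obtain ⟨v, rfl⟩ := hbij.2 w
    refine ⟨g v, ⟨⟨v, rfl⟩, hgq v⟩, ?_⟩
    rintro _ ⟨⟨u, rfl⟩, hu⟩
    rw [hf ((hgq u).symm.trans hu)]
  · rintro _ ⟨u, rfl⟩
    exact hg u

/-- If `M` meets a fibre of `g` in exactly one edge, then `t_M` sums to `2` over that fibre. -/
lemma sum_filter_tM {V E : Type*} [Fintype E] [DecidableEq V] {g : E → V} {M : Set E} {v : V}
    (h : ∃! e, e ∈ M ∧ g e = v) : ∑ e with g e = v, tM M e = 2 := by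
  obtain ⟨e, ⟨heM, hev⟩, huniq⟩ := h
  rw [Finset.sum_eq_single_of_mem e (by simpa using hev)]
  · exact Set.indicator_of_mem heM _
  · intro e' he' hne
    exact Set.indicator_of_notMem (fun hM => hne (huniq e' ⟨hM, by simpa using he'⟩)) _

lemma tM_mem_LGset {p : E → Vp} {q : E → Vn} {M : Set E} (hM : IsPerfectMatching p q M) :
    tM M ∈ LGset p q :=
  ⟨⟨fun v => sum_filter_tM (hM.1 v), fun v => sum_filter_tM (hM.2 v)⟩,
    fun _ => Set.indicator_nonneg (fun _ _ => zero_le_two) _⟩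

lemma tM_injective {E : Type*} : Function.Injective (tM : Set E → E → ℝ) := by
  intro M N h
  ext e
  have he := congrFun h e
  by_cases h1 : e ∈ M <;> by_cases h2 : e ∈ N <;> simp_all [tM]

/-- A nonnegative solution which is at least `2` on a perfect matching `M` equals `t_M`. -/
lemma eq_tM_of_two_le {p : E → Vp} {q : E → Vn} {M : Set E} (hM : IsPerfectMatching p q M)
    {t : E → ℝ} (ht : t ∈ LGset p q) (h2 : ∀ e ∈ M, 2 ≤ t e) : t = tM M := by
  have hle : ∀ e, tM M e ≤ t e := fun e => Set.indicator_le' h2 (fun e _ => ht.2 e) e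
  funext e
  have hsum : ∑ e' with p e' = p e, tM M e' = ∑ e' with p e' = p e, t e' :=
    (sum_filter_tM (hM.1 (p e))).trans (ht.1.1 (p e)).symm
  exact ((Finset.sum_eq_sum_iff_of_le fun e' _ => hle e').1 hsum e (by simp)).symm

/-- Two points of `𝖫_G` can be extrapolated as long as the result stays nonnegative. -/
lemma extrapolate_mem_LGset {p : E → Vp} {q : E → Vn} {s t : E → ℝ} (ht : t ∈ LGset p q)
    (hs : s ∈ LGset p q) {c : ℝ} (hc : c < 1) (hle : ∀ e, c * s e ≤ t e) :
    (fun e => (1 - c)⁻¹ * (t e - c * s e)) ∈ LGset p q := by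
  have hne : 1 - c ≠ 0 := by linarith
  refine ⟨⟨fun v => ?_, fun v => ?_⟩, fun e =>
    mul_nonneg (inv_nonneg.2 (by linarith)) (sub_nonneg.2 (hle e))⟩
  · rw [← Finset.mul_sum, Finset.sum_sub_distrib, ← Finset.mul_sum, ht.1.1, hs.1.1]
    field_simp
  · rw [← Finset.mul_sum, Finset.sum_sub_distrib, ← Finset.mul_sum, ht.1.2, hs.1.2]
    field_simp

/-- If `M` is the only perfect matching, every nonnegative solution equals `t_M`. -/
lemma eq_tM_of_unique {p : E → Vp} {q : E → Vn} {M : Set E} (hM : IsPerfectMatching p q M)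
    (huniq : ∀ N, IsPerfectMatching p q N → N = M) {t : E → ℝ} (ht : t ∈ LGset p q) :
    t = tM M := by
  refine eq_tM_of_two_le hM ht ?_
  by_contra! ⟨e₁, he₁, hlt₁⟩
  obtain ⟨e₀, he₀, hmin⟩ := Set.exists_min_image M t M.toFinite ⟨e₁, he₁⟩
  have hlt : t e₀ / 2 < 1 := by linarith [hmin e₁ he₁]
  have hmem := extrapolate_mem_LGset ht (tM_mem_LGset hM) hlt (by
    intro e
    by_cases he : e ∈ M
    · simpa [tM, he] using hmin e he
    · simpa [tM, he] using ht.2 e)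
  obtain ⟨N, hN, hpos⟩ := exists_isPerfectMatching_subset_support hmem
  simpa [tM, he₀] using hpos e₀ (huniq N hN ▸ he₀)

/-- `𝖫_G` consists of exactly one point iff `G` has exactly one perfect matching,
and in that case the unique nonnegative solution is `t_M` for the unique perfect
matching `M`. -/
theorem LGset_unique_iff_unique_perfectMatching (p : E → Vp) (q : E → Vn) :
    ((∃! t : E → ℝ, t ∈ LGset p q) ↔ (∃! M : Set E, IsPerfectMatching p q M)) ∧
    (∀ M : Set E, IsPerfectMatching p q M → (∃! t : E → ℝ, t ∈ LGset p q) →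
      LGset p q = {tM M}) := by
  refine ⟨⟨?_, ?_⟩, ?_⟩
  · rintro ⟨t, ht, huniq⟩
    obtain ⟨M, hM, -⟩ := exists_isPerfectMatching_subset_support ht
    exact ⟨M, hM, fun N hN => tM_injective <|
      (huniq _ (tM_mem_LGset hN)).trans (huniq _ (tM_mem_LGset hM)).symm⟩
  · rintro ⟨M, hM, huniq⟩
    exact ⟨tM M, tM_mem_LGset hM, fun t ht => eq_tM_of_unique hM huniq ht⟩
  · intro M hM hex
    exact Set.eq_singleton_iff_unique_mem.2
      ⟨tM_mem_LGset hM, fun t ht => hex.unique ht (tM_mem_LGset hM)⟩
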